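/- arXiv:2509.11650 — 3 statements merged into one kernel-verified Lean document; each statement's English description precedes it below -/
import Mathlib

section
/- For a > 0, ∫_{-∞}^{∞} (4/π)·e^{-a|τ|}·₃F₂(1,1,1; 3/2,3/2; e^{-2a|τ|}) dτ = 28ζ(3)/(aπ) - 8C/a, where ζ(3) is Apéry's constant and C is Catalan's constant. -/
open MeasureTheory Real

/-- Pochhammer (rising factorial) symbol `(a)_k`. -/
noncomputable def poch (a : ℝ) (k : ℕ) : ℝ := ∏ i ∈ Finset.range k, (a + i)

/-- The zero-balanced generalized hypergeometric series `₃F₂(1,1,1;3/2,3/2;z)`. -/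
noncomputable def F32 (z : ℝ) : ℝ :=
  ∑' k : ℕ, ((k.factorial : ℝ) / poch (3/2) k)^2 * z^k

/-- Apéry's constant `ζ(3)`. -/
noncomputable def zeta3 : ℝ := ∑' n : ℕ, 1 / ((n : ℝ) + 1)^3

/-- Catalan's constant. -/
noncomputable def catalanConst : ℝ := ∑' n : ℕ, (-1:ℝ)^n / (2*(n:ℝ) + 1)^2

open Filter Topology intervalIntegral

/-- Coefficients `k! / (3/2)_k`. -/
noncomputable def wk (k : ℕ) : ℝ := (k.factorial : ℝ) / poch (3/2) k

lemma poch_pos (k : ℕ) : 0 < poch (3/2) k := by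
  unfold poch
  exact Finset.prod_pos fun i _ => by positivity

lemma wk_pos (k : ℕ) : 0 < wk k := div_pos (by positivity) (poch_pos k)

lemma wk_zero : wk 0 = 1 := by simp [wk, poch]

lemma wk_succ (k : ℕ) : (2 * (k:ℝ) + 3) * wk (k+1) = (2 * k + 2) * wk k := by
  have h := (poch_pos k).ne'
  have h1 : poch (3/2) (k+1) = poch (3/2) k * (3/2 + k) := by
    simp [poch, Finset.prod_range_succ]
  have h2 : (3/2 + (k:ℝ)) ≠ 0 := by positivity
  unfold wk
  rw [h1, Nat.factorial_succ]
  push_cast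
  field_simp
  ring

lemma wk_sq_le (k : ℕ) : (wk k)^2 ≤ 1 / ((k:ℝ) + 1) := by
  induction k with
  | zero => simp [wk_zero]
  | succ n ih =>
    have h := wk_succ n
    have h1 : wk (n+1) = (2 * n + 2) / (2 * (n:ℝ) + 3) * wk n := by
      field_simp
      linarith
    rw [h1, mul_pow]
    calc ((2 * n + 2) / (2 * (n:ℝ) + 3))^2 * wk n ^ 2
        ≤ ((2 * n + 2) / (2 * (n:ℝ) + 3))^2 * (1 / ((n:ℝ) + 1)) := by gcongr
      _ ≤ 1 / (((n+1 : ℕ):ℝ) + 1) := by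
        push_cast
        rw [div_pow, div_mul_div_comm, div_le_div_iff₀ (by positivity) (by positivity)]
        have : (0:ℝ) ≤ n := by positivity
        nlinarith

lemma wk_tendsto : Tendsto wk atTop (𝓝 0) := by
  have h : Tendsto (fun k => (wk k)^2) atTop (𝓝 0) :=
    squeeze_zero (fun k => sq_nonneg _) wk_sq_le tendsto_one_div_add_atTop_nhds_zero_nat
  have h2 := (Real.continuous_sqrt.tendsto 0).comp h
  simp only [Real.sqrt_zero] at h2
  refine h2.congr fun k => ?_
  simp [Real.sqrt_sq (wk_pos k).le]

lemma integral_sin_odd (k : ℕ) : ∫ x in (0:ℝ)..(π/2), sin x ^ (2*k+1) = wk k := by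
  induction k with
  | zero => simp [wk_zero]
  | succ n ih =>
    have h := wk_succ n
    rw [show 2*(n+1)+1 = (2*n+1)+2 by ring, integral_sin_pow, ih]
    simp
    field_simp
    push_cast
    linear_combination (-1) * h

lemma integral_sin_even_cos (n : ℕ) :
    ∫ x in (0:ℝ)..(π/2), sin x ^ (2*n) * cos x = 1 / (2*n+1) := by
  have h := integral_sin_pow_mul_cos_pow_odd (a := 0) (b := π/2) (2*n) 0
  simp only [mul_zero, zero_add, pow_one, pow_zero, mul_one] at h
  rw [h]
  simp

lemma integral_J (k : ℕ) :
    ∫ x in (0:ℝ)..(π/2), (π/2 - x) * (sin x ^ (2*k) * cos x) = wk k / (2*k+1) := by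
  have hv : ∀ x ∈ Set.uIcc (0:ℝ) (π/2),
      HasDerivAt (fun x => sin x ^ (2*k+1) / (2*k+1)) (sin x ^ (2*k) * cos x) x := by
    intro x _
    have := ((hasDerivAt_sin x).pow (2*k+1)).div_const (2*(k:ℝ)+1)
    refine this.congr_deriv ?_
    have h0 : (2*(k:ℝ)+1) ≠ 0 := by positivity
    rw [Nat.add_sub_cancel]
    push_cast
    field_simp
  have hu : ∀ x ∈ Set.uIcc (0:ℝ) (π/2), HasDerivAt (fun x => π/2 - x) (-1) x := by
    intro x _
    simpa using (hasDerivAt_id x).const_sub (π/2)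
  rw [integral_mul_deriv_eq_deriv_mul hu hv (by simp)
    (Continuous.intervalIntegrable (by fun_prop) _ _)]
  simp [integral_sin_odd]

/-- Remainder of the arcsine-type series. -/
noncomputable def Rn (n : ℕ) (x : ℝ) : ℝ :=
  x - cos x * ∑ k ∈ Finset.range n, wk k * sin x ^ (2*k+1)

lemma Rn_deriv (n : ℕ) (x : ℝ) :
    HasDerivAt (Rn n) ((2*n+1) * wk n * sin x ^ (2*n)) x := by
  induction n with
  | zero =>
    have : Rn 0 = fun x => x := by ext x; simp [Rn]
    rw [this]
    simpa [wk_zero] using hasDerivAt_id' x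
  | succ n ih =>
    have h1 : Rn (n+1) = fun x => Rn n x - cos x * (wk n * sin x ^ (2*n+1)) := by
      ext x
      simp only [Rn, Finset.sum_range_succ]
      ring
    rw [h1]
    have h2 := ih.sub ((hasDerivAt_cos x).mul (((hasDerivAt_sin x).pow (2*n+1)).const_mul (wk n)))
    refine h2.congr_deriv ?_
    have h := wk_succ n
    have hc : cos x ^ 2 = 1 - sin x ^ 2 := by rw [← sin_sq_add_cos_sq x]; ring
    simp only [Nat.add_sub_cancel, Pi.pow_apply]
    push_cast
    rw [show 2*(n+1) = 2*n+2 by ring, pow_add, pow_succ]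
    linear_combination (-(wk n * (2*n+1) * sin x^(2*n))) * hc - sin x^(2*n) * sin x^2 * h

lemma Rn_zero (n : ℕ) : Rn n 0 = 0 := by simp [Rn]

lemma Rn_bounds (n : ℕ) {x : ℝ} (hx : 0 < x) (hx' : x ≤ π/2) :
    0 ≤ Rn n x ∧ Rn n x ≤ (2*n+1) * wk n * sin x ^ (2*n) * x := by
  obtain ⟨c, hc, h⟩ := exists_hasDerivAt_eq_slope (Rn n) (fun x => (2*n+1) * wk n * sin x ^ (2*n))
    hx (fun y _ => (Rn_deriv n y).continuousAt.continuousWithinAt) (fun y _ => Rn_deriv n y)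
  rw [Rn_zero, sub_zero, sub_zero, eq_div_iff hx.ne'] at h
  have hw := wk_pos n
  have hs : 0 ≤ sin c := sin_nonneg_of_nonneg_of_le_pi hc.1.le (by linarith [hc.2, pi_pos])
  have hsx : sin c ≤ sin x := sin_le_sin_of_le_of_le_pi_div_two (by linarith [hc.1, pi_pos]) hx' hc.2.le
  rw [← h]
  constructor
  · positivity
  · gcongr

/-- The function `x(π/2-x)/sin x`. -/
noncomputable def hh (x : ℝ) : ℝ := (π/2 - x) / sinc x

lemma sinc_pos' {x : ℝ} (hx : 0 ≤ x) (hx' : x ≤ π/2) : 0 < sinc x := by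
  rcases hx.eq_or_lt with h | h
  · simp [← h]
  · rw [sinc_of_ne_zero h.ne']
    exact div_pos (sin_pos_of_pos_of_lt_pi h (by linarith [pi_pos])) h

lemma hh_sin {x : ℝ} (hx : 0 ≤ x) (hx' : x ≤ π/2) : hh x * sin x = (π/2 - x) * x := by
  have h0 := (sinc_pos' hx hx').ne'
  rcases hx.eq_or_lt with h | h
  · simp [← h]
  · unfold hh
    have : sin x = sinc x * x := by rw [sinc_of_ne_zero h.ne']; field_simp
    rw [this]
    field_simp

lemma hh_cont : ContinuousOn hh (Set.uIcc 0 (π/2)) := by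
  rw [Set.uIcc_of_le (by positivity)]
  unfold hh
  refine ContinuousOn.div (by fun_prop) continuous_sinc.continuousOn ?_
  intro x hx
  exact (sinc_pos' hx.1 hx.2).ne'

lemma hh_int : IntervalIntegrable hh volume 0 (π/2) := hh_cont.intervalIntegrable

/-- The value of the integral. -/
noncomputable def LL : ℝ := ∫ x in (0:ℝ)..(π/2), hh x

lemma partA_pointwise (n : ℕ) {x : ℝ} (hx : 0 < x) (hx' : x ≤ π/2) :
    0 ≤ hh x - ∑ k ∈ Finset.range n, wk k * ((π/2 - x) * (sin x ^ (2*k) * cos x)) ∧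
    hh x - ∑ k ∈ Finset.range n, wk k * ((π/2 - x) * (sin x ^ (2*k) * cos x)) ≤
      (π^2/4) * ((2*n+1) * wk n) * (sin x ^ (2*n) * cos x) := by
  have hs : 0 < sin x := sin_pos_of_pos_of_lt_pi hx (by linarith [pi_pos])
  have hw := wk_pos n
  obtain ⟨h1, h2⟩ := Rn_bounds n hx hx'
  have key : hh x - ∑ k ∈ Finset.range n, wk k * ((π/2 - x) * (sin x ^ (2*k) * cos x))
      = (π/2 - x) * (Rn n x / sin x) := by
    have e1 : hh x = (π/2 - x) * x / sin x := by
      rw [eq_div_iff hs.ne', hh_sin hx.le hx']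
    rw [e1, Rn, sub_div, mul_sub, Finset.mul_sum, Finset.sum_div, Finset.mul_sum]
    congr 1
    · ring
    · refine Finset.sum_congr rfl fun k _ => ?_
      rw [pow_succ]
      field_simp
  rw [key]
  have hp : 0 ≤ π/2 - x := by linarith
  refine ⟨by positivity, ?_⟩
  have hxs : x ≤ π/2 * sin x := by
    have := mul_le_sin hx.le hx'
    have hpi := pi_pos
    rw [div_mul_eq_mul_div, div_le_iff₀ hpi] at this
    linarith
  have hcs : π/2 - x ≤ π/2 * cos x := by
    have := mul_le_sin hp (by linarith)
    have hpi := pi_pos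
    rw [div_mul_eq_mul_div, div_le_iff₀ hpi, sin_pi_div_two_sub] at this
    linarith
  have hr : Rn n x / sin x ≤ (2*n+1) * wk n * sin x ^ (2*n) * (π/2) := by
    rw [div_le_iff₀ hs]
    calc Rn n x ≤ _ := h2
      _ ≤ (2*n+1) * wk n * sin x ^ (2*n) * (π/2 * sin x) := by gcongr
      _ = _ := by ring
  calc (π/2 - x) * (Rn n x / sin x)
      ≤ (π/2 * cos x) * ((2*n+1) * wk n * sin x ^ (2*n) * (π/2)) := by
        apply mul_le_mul hcs hr (by positivity) (hp.trans hcs)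
    _ = _ := by ring

lemma partA (n : ℕ) :
    0 ≤ LL - ∑ k ∈ Finset.range n, (wk k)^2 / (2*k+1) ∧
    LL - ∑ k ∈ Finset.range n, (wk k)^2 / (2*k+1) ≤ (π^2/4) * wk n := by
  have hint : IntervalIntegrable (fun x => ∑ k ∈ Finset.range n,
      wk k * ((π/2 - x) * (sin x ^ (2*k) * cos x))) volume 0 (π/2) :=
    Continuous.intervalIntegrable (by fun_prop) _ _
  have e : LL - ∑ k ∈ Finset.range n, (wk k)^2 / (2*k+1) = ∫ x in (0:ℝ)..(π/2),
      (hh x - ∑ k ∈ Finset.range n, wk k * ((π/2 - x) * (sin x ^ (2*k) * cos x))) := by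
    rw [integral_sub hh_int hint, intervalIntegral.integral_finsetSum]
    · congr 1
      refine Finset.sum_congr rfl fun k _ => ?_
      rw [intervalIntegral.integral_const_mul, integral_J]
      ring
    · intro i _
      exact Continuous.intervalIntegrable (by fun_prop) _ _
  have e2 : (π^2/4) * wk n = ∫ x in (0:ℝ)..(π/2),
      (π^2/4) * ((2*n+1) * wk n) * (sin x ^ (2*n) * cos x) := by
    rw [intervalIntegral.integral_const_mul, integral_sin_even_cos]
    field_simp
  have hpi : (0:ℝ) ≤ π/2 := by positivity
  rw [e]
  constructor
  · rw [integral_of_le hpi]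
    exact setIntegral_nonneg measurableSet_Ioc fun x hx => (partA_pointwise n hx.1 hx.2).1
  · rw [e2]
    refine integral_mono_on_of_le_Ioo hpi (hh_int.sub hint)
      (Continuous.intervalIntegrable (by fun_prop) _ _) fun x hx => ?_
    exact (partA_pointwise n hx.1 hx.2.le).2

lemma sumA : Tendsto (fun n => ∑ k ∈ Finset.range n, (wk k)^2 / (2*(k:ℝ)+1)) atTop (𝓝 LL) := by
  have h : Tendsto (fun n => LL - ∑ k ∈ Finset.range n, (wk k)^2 / (2*(k:ℝ)+1)) atTop (𝓝 0) := by
    refine squeeze_zero (fun n => (partA n).1) (fun n => (partA n).2) ?_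
    simpa using wk_tendsto.const_mul (π^2/4)
  have := h.const_sub LL
  simpa using this

lemma hasSumA : HasSum (fun k : ℕ => (wk k)^2 / (2*(k:ℝ)+1)) LL := by
  rw [hasSum_iff_tendsto_nat_of_nonneg]
  · exact sumA
  · intro k; positivity

/-! Part B -/

lemma integral_g_sin (k : ℕ) :
    ∫ x in (0:ℝ)..(π/2), (π/2 - x) * x * sin ((2*k+1) * x)
      = 2 / (2*(k:ℝ)+1)^3 - (π/2) * ((-1)^k / (2*(k:ℝ)+1)^2) := by
  set m : ℝ := 2*(k:ℝ)+1 with hm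
  have hm0 : m ≠ 0 := by positivity
  have hd : ∀ x ∈ Set.uIcc (0:ℝ) (π/2), HasDerivAt
      (fun x => -((π/2 - x) * x) * cos (m*x) / m + (π/2 - 2*x) * sin (m*x) / m^2
        - 2 * cos (m*x) / m^3) ((π/2 - x) * x * sin (m * x)) x := by
    intro x _
    have hl : HasDerivAt (fun x => m * x) m x := by simpa using (hasDerivAt_id x).const_mul m
    have hc := hl.cos
    have hs := hl.sin
    have h1 : HasDerivAt (fun x : ℝ => -((π/2 - x) * x)) (-(π/2 - 2*x)) x := by
      have := (((hasDerivAt_id x).const_sub (π/2)).mul (hasDerivAt_id x)).neg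
      refine this.congr_deriv ?_
      simp
      ring
    have h2 : HasDerivAt (fun x : ℝ => π/2 - 2*x) (-2) x := by
      have := ((hasDerivAt_id x).const_mul 2).const_sub (π/2)
      simpa using this
    have := (((h1.mul hc).div_const m).add ((h2.mul hs).div_const (m^2))).sub
      ((hc.const_mul 2).div_const (m^3))
    refine this.congr_deriv ?_
    field_simp
    ring
  rw [integral_eq_sub_of_hasDerivAt hd (Continuous.intervalIntegrable (by fun_prop) _ _)]
  have e : m * (π/2) = π/2 + k * π := by rw [hm]; ring
  have hs : sin (m * (π/2)) = (-1)^k := by rw [e, sin_add_nat_mul_pi]; simp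
  have hc : cos (m * (π/2)) = 0 := by rw [e, cos_add_nat_mul_pi]; simp
  simp only [hs, hc]
  simp
  ring

lemma sin_sum (n : ℕ) (x : ℝ) :
    sin x * (2 * ∑ k ∈ Finset.range n, sin ((2*k+1) * x)) = 1 - cos (2*n*x) := by
  induction n with
  | zero => simp
  | succ n ih =>
    rw [Finset.sum_range_succ, mul_add, mul_add, ih]
    have e1 : cos (2*n*x) = cos ((2*n+1)*x - x) := by ring_nf
    have e2 : cos (2*((n+1:ℕ):ℝ)*x) = cos ((2*n+1)*x + x) := by push_cast; ring_nf
    rw [e1, e2, cos_sub, cos_add]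
    ring

lemma partB (n : ℕ) :
    ∑ k ∈ Finset.range n, 2 * (2 / (2*(k:ℝ)+1)^3 - (π/2) * ((-1)^k / (2*(k:ℝ)+1)^2))
      = LL - ∫ x in (0:ℝ)..(π/2), hh x * cos (2*n*x) := by
  have hi2 : IntervalIntegrable (fun x => hh x * cos (2*n*x)) volume 0 (π/2) :=
    (hh_cont.mul (by fun_prop)).intervalIntegrable
  rw [LL, ← integral_sub hh_int hi2]
  have : ∫ x in (0:ℝ)..(π/2), (hh x - hh x * cos (2*n*x)) =
      ∫ x in (0:ℝ)..(π/2), ∑ k ∈ Finset.range n, 2 * ((π/2 - x) * x * sin ((2*k+1) * x)) := by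
    refine integral_congr fun x hx => ?_
    rw [Set.uIcc_of_le (by positivity)] at hx
    have h1 := hh_sin hx.1 hx.2
    have h2 := sin_sum n x
    rw [← Finset.mul_sum, ← Finset.mul_sum, ← h1]
    linear_combination (-hh x) * h2
  rw [this, intervalIntegral.integral_finsetSum]
  · refine Finset.sum_congr rfl fun k _ => ?_
    rw [intervalIntegral.integral_const_mul, integral_g_sin]
  · intro i _
    exact Continuous.intervalIntegrable (by fun_prop) _ _

lemma RL : Tendsto (fun n : ℕ => ∫ x in (0:ℝ)..(π/2), hh x * cos (2*n*x)) atTop (𝓝 0) := by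
  have h := Real.tendsto_integral_exp_smul_cocompact
    ((Set.Ioc (0:ℝ) (π/2)).indicator (fun x => (hh x : ℂ)))
  have hn : Tendsto (fun n : ℕ => (n:ℝ) / π) atTop (cocompact ℝ) :=
    (tendsto_natCast_atTop_atTop.atTop_div_const pi_pos).mono_right atTop_le_cocompact
  have h2 := (Complex.continuous_re.tendsto 0).comp (h.comp hn)
  rw [Complex.zero_re] at h2
  refine h2.congr fun n => ?_
  simp only [Function.comp]
  have e1 : (fun v : ℝ => Real.fourierChar (-(v * ((n:ℝ)/π))) •
      (Set.Ioc (0:ℝ) (π/2)).indicator (fun x => (hh x : ℂ)) v)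
      = (Set.Ioc (0:ℝ) (π/2)).indicator
        (fun v => Complex.exp (((-(2*n*v) : ℝ) : ℂ) * Complex.I) * (hh v : ℂ)) := by
    ext v
    by_cases hv : v ∈ Set.Ioc (0:ℝ) (π/2)
    · simp only [Set.indicator_of_mem hv, Circle.smul_def, Real.fourierChar_apply, smul_eq_mul]
      congr 4
      have := pi_pos.ne'
      field_simp
    · simp [Set.indicator_of_notMem hv]
  rw [e1, MeasureTheory.integral_indicator measurableSet_Ioc, integral_of_le (by positivity)]
  have hcont : IntervalIntegrable (fun v : ℝ => Complex.exp (((-(2*n*v) : ℝ) : ℂ) * Complex.I) * (hh v : ℂ))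
      volume 0 (π/2) := by
    apply ContinuousOn.intervalIntegrable
    refine ContinuousOn.mul (by fun_prop) ?_
    exact Complex.continuous_ofReal.comp_continuousOn hh_cont
  rw [intervalIntegrable_iff_integrableOn_Ioc_of_le (by positivity)] at hcont
  rw [← RCLike.re_to_complex, ← integral_re hcont]
  refine integral_congr_ae (ae_of_all _ fun v => ?_)
  simp only [RCLike.re_to_complex]
  rw [Complex.re_mul_ofReal, Complex.exp_ofReal_mul_I_re, cos_neg, mul_comm]

lemma odd_cubes : HasSum (fun k : ℕ => 1 / (2*(k:ℝ)+1)^3) (7/8 * zeta3) := by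
  have hz : Summable (fun n : ℕ => 1 / ((n:ℝ)+1)^3) := by
    have := (summable_nat_add_iff 1).mpr (Real.summable_one_div_nat_pow.mpr (by norm_num : 1 < 3))
    simpa using this
  have he : Summable (fun k : ℕ => 1 / (((2*k : ℕ):ℝ)+1)^3) :=
    hz.comp_injective (i := fun k => 2*k) (fun a b h => by simpa using h)
  have ho : Summable (fun k : ℕ => 1 / (((2*k+1 : ℕ):ℝ)+1)^3) :=
    hz.comp_injective (i := fun k => 2*k+1) (fun a b h => by simpa using h)
  have h := tsum_even_add_odd (f := fun n : ℕ => 1 / ((n:ℝ)+1)^3) he ho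
  have ho' : ∑' k : ℕ, 1 / (((2*k+1 : ℕ):ℝ)+1)^3 = 1/8 * zeta3 := by
    rw [zeta3, ← tsum_mul_left]
    refine tsum_congr fun k => ?_
    have hk : (((2*k+1 : ℕ):ℝ)+1) = 2 * ((k:ℝ)+1) := by push_cast; ring
    rw [hk, mul_pow, one_div_mul_one_div]
    norm_num
  have hs := he.hasSum
  have : ∑' k : ℕ, 1 / (((2*k : ℕ):ℝ)+1)^3 = 7/8 * zeta3 := by
    rw [ho', ← zeta3] at h
    linarith
  rw [this] at hs
  simpa only [Nat.cast_mul, Nat.cast_ofNat] using hs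

lemma catalan_hasSum : HasSum (fun n : ℕ => (-1:ℝ)^n / (2*(n:ℝ) + 1)^2) catalanConst := by
  apply Summable.hasSum
  have hz : Summable (fun n : ℕ => 1 / ((n:ℝ)+1)^2) := by
    have := (summable_nat_add_iff 1).mpr (Real.summable_one_div_nat_pow.mpr (by norm_num : 1 < 2))
    simpa using this
  refine Summable.of_norm_bounded hz fun n => ?_
  rw [norm_div, norm_pow, norm_neg, norm_one, one_pow, Real.norm_of_nonneg (by positivity)]
  have : (0:ℝ) ≤ n := by positivity
  gcongr
  linarith

lemma LL_eq : LL = 7/2 * zeta3 - π * catalanConst := by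
  have h1 := ((odd_cubes.mul_left 4).sub (catalan_hasSum.mul_left π)).tendsto_sum_nat
  have h2 : Tendsto (fun n : ℕ => LL - ∫ x in (0:ℝ)..(π/2), hh x * cos (2*n*x)) atTop (𝓝 LL) := by
    simpa using RL.const_sub LL
  have h3 := tendsto_nhds_unique (h2.congr fun n => (partB n).symm) (h1.congr fun n => ?_)
  · rw [h3]; ring
  · refine Finset.sum_congr rfl fun k _ => ?_
    ring

theorem lorentzian_autocovariance_bound_integral (a : ℝ) (ha : 0 < a) :
    (∫ τ : ℝ, (4/π) * Real.exp (-a * |τ|) * F32 (Real.exp (-2*a*|τ|)))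
      = 28 * zeta3 / (a * π) - 8 * catalanConst / a := by
  have hpi := pi_pos
  rw [integral_comp_abs (f := fun τ => (4/π) * Real.exp (-a * τ) * F32 (Real.exp (-2*a*τ)))]
  let F : ℕ → ℝ → ℝ := fun k τ => (4/π) * (wk k)^2 * Real.exp (-(a*(2*k+1)) * τ)
  have hneg : ∀ k : ℕ, -(a*(2*(k:ℝ)+1)) < 0 := fun k => by
    have : 0 < a*(2*(k:ℝ)+1) := by positivity
    linarith
  have hFint : ∀ k, Integrable (F k) (volume.restrict (Set.Ioi 0)) := fun k =>
    (integrableOn_exp_mul_Ioi (hneg k) 0).const_mul _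
  have hval : ∀ k, ∫ τ in Set.Ioi (0:ℝ), F k τ = (4/(π*a)) * ((wk k)^2 / (2*k+1)) := by
    intro k
    simp only [F]
    rw [MeasureTheory.integral_const_mul, integral_exp_mul_Ioi (hneg k)]
    simp
    field_simp
  have hs := hasSumA.mul_left (4/(π*a))
  have hnorm : ∀ k τ, ‖F k τ‖ = F k τ := fun k τ => Real.norm_of_nonneg (by positivity)
  have hsum : Summable fun k => ∫ τ in Set.Ioi (0:ℝ), ‖F k τ‖ := by
    simp only [hnorm, hval]
    exact hs.summable
  have h := hasSum_integral_of_summable_integral_norm hFint hsum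
  simp only [hval] at h
  have h2 := h.unique hs
  have e : ∀ τ : ℝ, (4/π) * Real.exp (-a * τ) * F32 (Real.exp (-2*a*τ)) = ∑' k, F k τ := by
    intro τ
    rw [F32, ← tsum_mul_left]
    refine tsum_congr fun k => ?_
    simp only [F, wk]
    rw [← Real.exp_nat_mul, show -(a*(2*(k:ℝ)+1)) * τ = -a*τ + k * (-2*a*τ) by ring, Real.exp_add]
    ring
  simp only [e]
  rw [h2, LL_eq]
  field_simp
  ring
end

section
/- For complex r with 0 < |r| < 1, the zeroth-order coefficient of the expansion satisfies Ω₀ = -ln(1-|r|²)/r, where Ω₀ = -(1/(2π)²)·∫₀^∞∫₀^∞ e^{-(v₁²+v₂²)/4} ∫₀^{2π}∫₀^{2π} e^{-(|r| v₁ v₂/2) cos(q₁-q₂+φ)} e^{i(q₁-q₂)} dq₁ dq₂ dv₁ dv₂, with r = |r| e^{iφ}. -/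
open MeasureTheory Real

/-- The zeroth-order coefficient `Ω₀` as a 4-fold integral. -/
noncomputable def Omega0 (c φ : ℝ) : ℂ :=
  -(1/(2*π)^2 : ℂ) * ∫ v₁ in Set.Ioi (0:ℝ), ∫ v₂ in Set.Ioi (0:ℝ),
    ∫ q₁ in Set.Ioo (0:ℝ) (2*π), ∫ q₂ in Set.Ioo (0:ℝ) (2*π),
      Complex.exp (-(((v₁^2 + v₂^2)/4 : ℝ) : ℂ)) *
      Complex.exp (-(((c*v₁*v₂/2) * Real.cos (q₁ - q₂ + φ) : ℝ) : ℂ)) *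
      Complex.exp (Complex.I * (((q₁ - q₂ : ℝ)) : ℂ))

lemma W_even (k : ℕ) : ∫ t in (0:ℝ)..(2*π), cos t ^ (2*k) =
    2 * π * ((2*k).factorial : ℝ) / (4^k * (k.factorial : ℝ)^2) := by
  induction k with
  | zero => simp
  | succ k ih =>
    rw [show 2*(k+1) = 2*k+2 by ring, integral_cos_pow, ih]
    simp only [Nat.factorial_succ, sin_two_pi, sin_zero]
    have : (k.factorial : ℝ) ≠ 0 := by positivity
    have : (k:ℝ) + 1 ≠ 0 := by positivity
    push_cast
    field_simp
    ring

lemma W_odd (k : ℕ) : ∫ t in (0:ℝ)..(2*π), cos t ^ (2*k+1) = 0 := by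
  have := @integral_sin_pow_mul_cos_pow_odd 0 (2*π) 0 k
  simpa using this

lemma S_zero (n : ℕ) : ∫ t in (0:ℝ)..(2*π), sin t * cos t ^ n = 0 := by
  have := @integral_sin_pow_odd_mul_cos_pow 0 (2*π) 0 n
  simpa using this

lemma C_int (n : ℕ) : ∫ t in (0:ℝ)..(2*π), ((cos t : ℝ) : ℂ)^n * Complex.exp (Complex.I * (t:ℂ))
    = ((∫ t in (0:ℝ)..(2*π), cos t ^ (n+1) : ℝ) : ℂ) := by
  have h : ∀ t : ℝ, ((cos t : ℝ) : ℂ)^n * Complex.exp (Complex.I * (t:ℂ))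
      = ((cos t ^ (n+1) : ℝ) : ℂ) + Complex.I * ((sin t * cos t ^ n : ℝ) : ℂ) := by
    intro t
    rw [mul_comm Complex.I, Complex.exp_mul_I]
    push_cast
    ring
  simp_rw [h]
  rw [intervalIntegral.integral_add, intervalIntegral.integral_const_mul,
    intervalIntegral.integral_ofReal, intervalIntegral.integral_ofReal, S_zero]
  · simp
  · exact Continuous.intervalIntegrable (by fun_prop) _ _
  · exact Continuous.intervalIntegrable (by fun_prop) _ _

/-- coefficients of the Bessel series -/
noncomputable def bC (k : ℕ) : ℝ := 1 / (2^(2*k+1) * (k.factorial : ℝ) * ((k+1).factorial : ℝ))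

lemma J_hasSum (x : ℝ) : HasSum (fun k : ℕ => ((-(2*π) * (bC k * x^(2*k+1)) : ℝ) : ℂ))
    (∫ t in (0:ℝ)..(2*π), Complex.exp (-((x * cos t : ℝ) : ℂ)) * Complex.exp (Complex.I * (t:ℂ))) := by
  have key : HasSum (fun n : ℕ => ∫ t in (0:ℝ)..(2*π),
      ((-x)^n / (n.factorial) : ℂ) * (((cos t : ℝ) : ℂ)^n * Complex.exp (Complex.I * (t:ℂ))))
    (∫ t in (0:ℝ)..(2*π), Complex.exp (-((x * cos t : ℝ) : ℂ)) * Complex.exp (Complex.I * (t:ℂ))) := by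
    refine intervalIntegral.hasSum_integral_of_dominated_convergence
      (fun n _ => |x|^n / (n.factorial)) ?_ ?_ ?_ ?_ ?_
    · intro n
      exact Continuous.aestronglyMeasurable (by fun_prop)
    · intro n
      refine Filter.Eventually.of_forall fun t _ => ?_
      rw [mul_comm Complex.I]
      simp only [norm_mul, norm_div, norm_pow, norm_neg, Complex.norm_exp_ofReal_mul_I,
        Complex.norm_real, Complex.norm_natCast, mul_one, Real.norm_eq_abs]
      exact mul_le_of_le_one_right (by positivity) (pow_le_one₀ (abs_nonneg _) (abs_cos_le_one t))
    · exact Filter.Eventually.of_forall fun t _ => summable_pow_div_factorial _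
    · exact intervalIntegrable_const
    · refine Filter.Eventually.of_forall fun t _ => ?_
      have := (NormedSpace.expSeries_div_hasSum_exp (-((x * cos t : ℝ) : ℂ))).mul_right
        (Complex.exp (Complex.I * (t:ℂ)))
      rw [← Complex.exp_eq_exp_ℂ] at this
      have e : ∀ n : ℕ, ((-x)^n / (n.factorial) : ℂ) * (((cos t : ℝ) : ℂ)^n * Complex.exp (Complex.I * (t:ℂ)))
          = (-((x * cos t : ℝ) : ℂ))^n / (n.factorial) * Complex.exp (Complex.I * (t:ℂ)) := by
        intro n
        push_cast
        rw [← neg_mul, mul_pow]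
        ring
      simp_rw [e]
      exact this
  simp_rw [intervalIntegral.integral_const_mul, C_int] at key
  have inj : Function.Injective (fun k : ℕ => 2*k+1) := fun a b h => by simpa using h
  rw [← inj.hasSum_iff] at key
  · convert key using 2 with k
    simp only [Function.comp, show 2*k+1+1 = 2*(k+1) by ring, W_even, bC]
    rw [show 2*(k+1) = 2*k+1+1 by ring, Nat.factorial_succ (2*k+1), Nat.factorial_succ k]
    have : (k.factorial : ℂ) ≠ 0 := by exact_mod_cast k.factorial_ne_zero
    have : ((2*k+1).factorial : ℂ) ≠ 0 := by exact_mod_cast (2*k+1).factorial_ne_zero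
    have : (k : ℂ) + 1 ≠ 0 := by exact_mod_cast k.succ_ne_zero
    have h4 : (4:ℂ)^(k+1) = 2^(2*k+1) * 2 := by rw [← pow_succ, show 2*k+1+1 = 2*(k+1) by ring, pow_mul]; norm_num
    push_cast
    rw [h4, Odd.neg_pow (by simp)]
    field_simp
    ring
  · intro n hn
    rcases Nat.even_or_odd' n with ⟨k, rfl | rfl⟩
    · simp [W_odd]
    · exact absurd ⟨k, rfl⟩ hn

lemma angular (x φ : ℝ) :
    ∫ q₁ in Set.Ioo (0:ℝ) (2*π), ∫ q₂ in Set.Ioo (0:ℝ) (2*π),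
      Complex.exp (-((x * Real.cos (q₁ - q₂ + φ) : ℝ) : ℂ)) *
      Complex.exp (Complex.I * (((q₁ - q₂ : ℝ)) : ℂ)) =
    (2*π : ℂ) * Complex.exp (-(Complex.I * φ)) *
    ∫ t in (0:ℝ)..(2*π), Complex.exp (-((x * cos t : ℝ) : ℂ)) * Complex.exp (Complex.I * (t:ℂ)) := by
  set f : ℝ → ℂ := fun t => Complex.exp (-((x * cos t : ℝ) : ℂ)) * Complex.exp (Complex.I * (t:ℂ)) with hf
  have hper : Function.Periodic f (2*π) := by
    intro t
    simp only [hf, cos_add_two_pi]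
    congr 1
    push_cast
    rw [mul_add, Complex.exp_add, show Complex.I * (2 * (π:ℂ)) = 2 * π * Complex.I by ring,
      Complex.exp_two_pi_mul_I, mul_one]
  have h2pi : (0:ℝ) ≤ 2*π := by positivity
  have inner : ∀ q₁ : ℝ, ∫ q₂ in Set.Ioo (0:ℝ) (2*π),
      Complex.exp (-((x * Real.cos (q₁ - q₂ + φ) : ℝ) : ℂ)) *
      Complex.exp (Complex.I * (((q₁ - q₂ : ℝ)) : ℂ)) =
      Complex.exp (-(Complex.I * φ)) * ∫ t in (0:ℝ)..(2*π), f t := by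
    intro q₁
    rw [← integral_Ioc_eq_integral_Ioo, ← intervalIntegral.integral_of_le h2pi]
    have : ∀ q₂ : ℝ, Complex.exp (-((x * Real.cos (q₁ - q₂ + φ) : ℝ) : ℂ)) *
      Complex.exp (Complex.I * (((q₁ - q₂ : ℝ)) : ℂ)) =
        Complex.exp (-(Complex.I * φ)) * f ((q₁ + φ) - q₂) := by
      intro q₂
      simp only [hf]
      rw [show q₁ + φ - q₂ = q₁ - q₂ + φ by ring, mul_left_comm, ← Complex.exp_add (-(Complex.I * φ))]
      congr 2
      push_cast
      ring
    simp_rw [this]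
    rw [intervalIntegral.integral_const_mul, intervalIntegral.integral_comp_sub_left]
    congr 1
    have := hper.intervalIntegral_add_eq (q₁ + φ - 2*π) 0
    rw [zero_add] at this
    rw [← this]
    congr 1
    ring
  simp_rw [inner]
  rw [setIntegral_const]
  simp [Measure.real, mul_assoc, ENNReal.toReal_ofReal, pi_pos.le]

noncomputable def mT (k : ℕ) (v : ℝ) : ℝ := v^(2*k+1) * exp (-(v^2/4))

noncomputable def mM (k : ℕ) : ℝ := 4^(k+1) * (k.factorial : ℝ) / 2

lemma mT_eq (k : ℕ) (v : ℝ) : mT k v = v^((2*k+1 : ℕ) : ℝ) * exp (-(1/4) * v^2) := by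
  rw [mT, rpow_natCast]; congr 2; ring

lemma mT_int (k : ℕ) : IntegrableOn (mT k) (Set.Ioi 0) := by
  have := integrableOn_rpow_mul_exp_neg_mul_sq (b := 1/4) (by norm_num) (s := ((2*k+1 : ℕ) : ℝ))
    (by have : (0:ℝ) ≤ ((2*k+1 : ℕ) : ℝ) := by positivity
        linarith)
  exact this.congr_fun (fun v _ => (mT_eq k v).symm) measurableSet_Ioi

lemma mT_val (k : ℕ) : ∫ v in Set.Ioi (0:ℝ), mT k v = mM k := by
  have := integral_rpow_mul_exp_neg_mul_rpow (b := 1/4) (p := 2) (q := ((2*k+1 : ℕ) : ℝ)) (by norm_num)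
    (by have : (0:ℝ) ≤ ((2*k+1 : ℕ) : ℝ) := by positivity
        linarith) (by norm_num)
  simp_rw [mT_eq]
  simp_rw [rpow_two] at this
  rw [this, show (((2*k+1 : ℕ) : ℝ) + 1) / 2 = k + 1 by push_cast; ring,
    show -(((2*k+1 : ℕ) : ℝ) + 1) / 2 = -((k + 1 : ℕ) : ℝ) by push_cast; ring, Gamma_nat_eq_factorial,
    rpow_neg (by norm_num), rpow_natCast, mM]
  simp
  ring

lemma mT_nonneg (k : ℕ) {v : ℝ} (hv : 0 < v) : 0 ≤ mT k v := by
  unfold mT; positivity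

/-- integrating a nonnegative series of `mT k` -/
lemma series_int (a : ℕ → ℝ) (ha : ∀ k, 0 ≤ a k) (hs : Summable fun k => a k * mM k) :
    HasSum (fun k => a k * mM k) (∫ v in Set.Ioi (0:ℝ), ∑' k, a k * mT k v) := by
  have := hasSum_integral_of_summable_integral_norm (μ := volume.restrict (Set.Ioi (0:ℝ)))
    (F := fun k v => a k * mT k v) (fun k => (mT_int k).const_mul (a k)) ?_
  · simpa [integral_const_mul, mT_val] using this
  · convert hs using 2 with k
    rw [← mT_val, ← integral_const_mul]
    refine setIntegral_congr_fun measurableSet_Ioi fun v hv => ?_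
    exact Real.norm_of_nonneg (mul_nonneg (ha k) (mT_nonneg k hv))

lemma radial (c : ℝ) (h0 : 0 < c) (h1 : c < 1) :
    ∫ v₁ in Set.Ioi (0:ℝ), ∫ v₂ in Set.Ioi (0:ℝ),
      ∑' k, (bC k * (c/2)^(2*k+1) * mT k v₁) * mT k v₂ = - log (1 - c^2) / c := by
  have hb : ∀ k, 0 ≤ bC k := fun k => by unfold bC; positivity
  have e1 : ∀ k, bC k * (c/2)^(2*k+1) * mM k * mM k = c^(2*k+1) / (k+1) := by
    intro k
    have h2 : (4:ℝ)^(k+1) = 2^(2*k+1) * 2 := by rw [← pow_succ, show 2*k+1+1 = 2*(k+1) by ring, pow_mul]; norm_num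
    have : (k.factorial : ℝ) ≠ 0 := by positivity
    have : (k:ℝ) + 1 ≠ 0 := by positivity
    rw [bC, mM, h2, Nat.factorial_succ, div_pow]
    push_cast
    field_simp
  have e2 : ∀ k : ℕ, c^(2*k+1) / ((k:ℝ)+1) = (c^2)^(k+1) / ((k:ℝ)+1) / c := by
    intro k
    have : (k:ℝ) + 1 ≠ 0 := by positivity
    field_simp
    ring
  have hlog : HasSum (fun k => bC k * (c/2)^(2*k+1) * mM k * mM k) (- log (1 - c^2) / c) := by
    simp_rw [e1, e2]
    exact (hasSum_pow_div_log_of_abs_lt_one (by rw [abs_of_pos (by positivity)]; nlinarith)).div_const c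
  have inner : ∀ v₁ ∈ Set.Ioi (0:ℝ), ∫ v₂ in Set.Ioi (0:ℝ),
      ∑' k, (bC k * (c/2)^(2*k+1) * mT k v₁) * mT k v₂
      = ∑' k, (bC k * (c/2)^(2*k+1) * mM k) * mT k v₁ := by
    intro v hv
    have hv' : 0 < v := hv
    have := series_int (fun k => bC k * (c/2)^(2*k+1) * mT k v)
      (fun k => mul_nonneg (mul_nonneg (hb k) (by positivity)) (mT_nonneg k hv)) ?_
    · rw [← this.tsum_eq]
      refine tsum_congr fun k => by ring
    · have hs := ((summable_nat_add_iff 1).2 (summable_pow_div_factorial (c^2*v^2/4))).mul_left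
        (4 / (c * v) * exp (-(v^2/4)))
      refine hs.of_nonneg_of_le (fun k => ?_) (fun k => ?_)
      · have := mT_nonneg k hv
        have := hb k
        have : 0 ≤ mM k := by unfold mM; positivity
        positivity
      · have h2 : (4:ℝ)^(k+1) = 2^(2*k+1) * 2 := by rw [← pow_succ, show 2*k+1+1 = 2*(k+1) by ring, pow_mul]; norm_num
        have : (k.factorial : ℝ) ≠ 0 := by positivity
        have : ((k+1).factorial : ℝ) ≠ 0 := by positivity
        rw [bC, mM, mT, div_pow (c^2*v^2), h2, div_pow]
        apply le_of_sub_nonneg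
        have : (0:ℝ) ≤ exp (-(v^2/4)) * c^(2*k+1) * v^(2*k+1) / (2^(2*k+1) * ((k+1).factorial : ℝ)) := by positivity
        convert this using 1
        field_simp
        ring
  rw [setIntegral_congr_fun measurableSet_Ioi inner]
  exact (series_int _ (fun k => mul_nonneg (mul_nonneg (hb k) (by positivity))
    (by unfold mM; positivity)) hlog.summable).unique hlog

/-- `Ω₀ = -ln(1-|r|²)/r` for `0 < |r| < 1`. -/
theorem Omega0_closed_form (r : ℂ) (φ : ℝ)
    (h0 : 0 < ‖r‖) (h1 : ‖r‖ < 1)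
    (hφ : r = (‖r‖ : ℂ) * Complex.exp (Complex.I * (φ : ℂ))) :
    Omega0 ‖r‖ φ = -((Real.log (1 - ‖r‖^2) : ℂ)) / r := by
  set c := ‖r‖ with hc
  have hin : ∀ v₁ v₂ : ℝ, (∫ q₁ in Set.Ioo (0:ℝ) (2*π), ∫ q₂ in Set.Ioo (0:ℝ) (2*π),
      Complex.exp (-(((v₁^2 + v₂^2)/4 : ℝ) : ℂ)) *
      Complex.exp (-(((c*v₁*v₂/2) * Real.cos (q₁ - q₂ + φ) : ℝ) : ℂ)) *
      Complex.exp (Complex.I * (((q₁ - q₂ : ℝ)) : ℂ))) =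
      (-(2*π)^2 * Complex.exp (-(Complex.I * φ))) *
        ((∑' k, (bC k * (c/2)^(2*k+1) * mT k v₁) * mT k v₂ : ℝ) : ℂ) := by
    intro v₁ v₂
    simp_rw [mul_assoc (Complex.exp (-(((v₁^2 + v₂^2)/4 : ℝ) : ℂ))), integral_const_mul]
    rw [angular, ← (J_hasSum (c*v₁*v₂/2)).tsum_eq, ← Complex.ofReal_tsum, tsum_mul_left]
    have : ∀ k, (bC k * (c/2)^(2*k+1) * mT k v₁) * mT k v₂ =
        exp (-((v₁^2+v₂^2)/4)) * (bC k * (c*v₁*v₂/2)^(2*k+1)) := by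
      intro k
      rw [mT, mT, show -((v₁^2+v₂^2)/4) = -(v₁^2/4) + -(v₂^2/4) by ring, exp_add,
        show c*v₁*v₂/2 = c/2*v₁*v₂ by ring, mul_pow, mul_pow]
      ring
    simp_rw [this, tsum_mul_left]
    push_cast
    ring
  have hrad := radial c h0 h1
  unfold Omega0
  simp_rw [hin, integral_const_mul, integral_complex_ofReal]
  rw [hrad, Complex.exp_neg]
  have hpi : (π:ℂ) ≠ 0 := by exact_mod_cast pi_ne_zero
  have hc0 : (c:ℂ) ≠ 0 := by exact_mod_cast h0.ne'
  have he := Complex.exp_ne_zero (Complex.I * φ)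
  rw [show -((Real.log (1 - c^2) : ℂ)) / r =
    -((Real.log (1 - c^2) : ℂ)) / (c * Complex.exp (Complex.I * φ)) from by rw [← hφ]]
  push_cast
  field_simp
end

section
/- For a complex circular Gaussian random variable w with mean 0 and E[|w|²] = σ², and any complex w₀ ≠ 0, E[1/(w + w₀)] exists, and |E[1/(w+w₀)]|² = (1/σ²)·((1 - e^{-ω²})/ω)² where ω = |w₀|/σ. -/
open MeasureTheory ProbabilityTheory Complex

lemma aux_integrable_G (σ : ℝ) (hσ : 0 < σ) :
    Integrable (fun p : ℝ × ℝ => Real.exp (-(p.1 ^ 2 + p.2 ^ 2) / σ ^ 2)) := by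
  have h1 : Integrable (fun x : ℝ => Real.exp (-(1 / σ ^ 2) * x ^ 2)) :=
    integrable_exp_neg_mul_sq (by positivity)
  have h2 := h1.mul_prod h1
  refine h2.congr (Filter.Eventually.of_forall fun p => ?_)
  simp only
  rw [← Real.exp_add]
  congr 1
  ring

lemma aux_norm_le (p : ℝ × ℝ) : ‖p‖ ≤ ‖(p.1 : ℂ) + I * (p.2 : ℂ)‖ := by
  rw [Prod.norm_def, Real.norm_eq_abs, Real.norm_eq_abs]
  have h1 := Complex.abs_re_le_norm ((p.1 : ℂ) + I * (p.2 : ℂ))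
  have h2 := Complex.abs_im_le_norm ((p.1 : ℂ) + I * (p.2 : ℂ))
  simp at h1 h2
  exact max_le h1 h2

lemma aux_integrable_V0 :
    IntegrableOn (fun p : ℝ × ℝ => 1 / ((p.1 : ℂ) + I * (p.2 : ℂ))) (Metric.ball 0 1) := by
  refine integrableOn_ball_of_norm_le_rpow (C := 1) (α := 1) (by simp) (by simp) ?_ ?_
  · refine Filter.Eventually.of_forall fun p => ?_
    rw [Real.rpow_neg_one, one_mul, norm_div, norm_one, one_div]
    by_cases hp : p = 0
    · simp [hp]
    · exact inv_anti₀ (norm_pos_iff.2 hp) (aux_norm_le p)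
  · exact Measurable.aestronglyMeasurable (by fun_prop)

lemma aux_integrable (σ : ℝ) (hσ : 0 < σ) (w₀ : ℂ) :
    Integrable (fun p : ℝ × ℝ => Real.exp (-(p.1 ^ 2 + p.2 ^ 2) / σ ^ 2) •
      (1 / ((p.1 : ℂ) + I * (p.2 : ℂ) + w₀))) := by
  have h1 := (integrable_indicator_iff measurableSet_ball).2 aux_integrable_V0
  have h2 := (h1.comp_sub_right ((-w₀.re, -w₀.im) : ℝ × ℝ)).norm.add (aux_integrable_G σ hσ)
  refine h2.mono' (Measurable.aestronglyMeasurable (by fun_prop))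
    (Filter.Eventually.of_forall fun p => ?_)
  simp only [Pi.add_apply]
  set q : ℝ × ℝ := p - (-w₀.re, -w₀.im) with hq
  have e : (p.1 : ℂ) + I * (p.2 : ℂ) + w₀ = (q.1 : ℂ) + I * (q.2 : ℂ) := by
    rw [hq]
    apply Complex.ext <;> simp
  rw [e, norm_smul, Real.norm_eq_abs, Real.abs_exp]
  have hG : Real.exp (-(p.1 ^ 2 + p.2 ^ 2) / σ ^ 2) ≤ 1 := by
    rw [Real.exp_le_one_iff, neg_div]
    have : 0 ≤ (p.1 ^ 2 + p.2 ^ 2) / σ ^ 2 := by positivity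
    linarith
  have hG0 := Real.exp_pos (-(p.1 ^ 2 + p.2 ^ 2) / σ ^ 2)
  by_cases hb : q ∈ Metric.ball (0 : ℝ × ℝ) 1
  · rw [Set.indicator_of_mem hb]
    have := mul_le_mul_of_nonneg_right hG (norm_nonneg (1 / ((q.1 : ℂ) + I * (q.2 : ℂ))))
    linarith
  · rw [Set.indicator_of_notMem hb, norm_zero, zero_add]
    have h3 : 1 ≤ ‖(q.1 : ℂ) + I * (q.2 : ℂ)‖ := by
      refine le_trans ?_ (aux_norm_le q)
      simpa using hb
    have h4 : ‖1 / ((q.1 : ℂ) + I * (q.2 : ℂ))‖ ≤ 1 := by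
      rw [norm_div, norm_one, one_div]
      exact inv_le_one_of_one_le₀ h3
    exact mul_le_of_le_one_right hG0.le h4

lemma aux_avg_lt (w₀ : ℂ) (r : ℝ) (hr : 0 < r) (h : r < ‖w₀‖) :
    Real.circleAverage (fun z => 1 / (z + w₀)) 0 r = 1 / w₀ := by
  have hd : DifferentiableOn ℂ (fun z : ℂ => 1 / (z + w₀)) (Metric.closedBall 0 |r|) := by
    intro z hz
    have hz' : z + w₀ ≠ 0 := by
      intro h0
      have : z = -w₀ := eq_neg_of_add_eq_zero_left h0
      simp [this, abs_of_pos hr] at hz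
      linarith
    apply DifferentiableAt.differentiableWithinAt
    fun_prop (disch := exact hz')
  rw [DiffContOnCl.circleAverage]
  · simp
  · exact DifferentiableOn.diffContOnCl_ball hd subset_rfl

lemma aux_avg_gt (w₀ : ℂ) (hw₀ : w₀ ≠ 0) (r : ℝ) (hr : 0 < r) (h : ‖w₀‖ < r) :
    Real.circleAverage (fun z => 1 / (z + w₀)) 0 r = 0 := by
  have h1 : Real.circleAverage (fun z : ℂ => ((z - 0) / (z - (-w₀))) • (1 : ℂ)) 0 r = 1 :=
    DiffContOnCl.circleAverage_smul_div (f := fun _ => (1 : ℂ)) diffContOnCl_const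
      (by simpa [abs_of_pos hr] using h)
  have hne : ∀ z ∈ Metric.sphere (0 : ℂ) |r|, z + w₀ ≠ 0 := by
    intro z hz h0
    have : z = -w₀ := eq_neg_of_add_eq_zero_left h0
    simp [this, abs_of_pos hr] at hz
    linarith
  have hci : CircleIntegrable (fun z : ℂ => ((z - 0) / (z - (-w₀))) • (1 : ℂ)) 0 r := by
    apply ContinuousOn.circleIntegrable'
    intro z hz
    have : z - (-w₀) ≠ 0 := by simpa using hne z hz
    apply ContinuousAt.continuousWithinAt
    fun_prop (disch := exact this)
  have h2 : Real.circleAverage (fun z : ℂ => 1 / (z + w₀)) 0 r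
      = Real.circleAverage (fun z : ℂ => (1 / w₀) •
        ((1 : ℂ) - ((z - 0) / (z - (-w₀))) • (1 : ℂ))) 0 r := by
    apply Real.circleAverage_congr_sphere
    intro z hz
    have := hne z hz
    simp only [smul_eq_mul, sub_neg_eq_add, sub_zero, mul_one]
    field_simp
    ring
  rw [h2, Real.circleAverage_fun_smul, Real.circleAverage_fun_sub (circleIntegrable_const _ _ _) hci,
    h1, Real.circleAverage_const]
  simp

lemma aux_angle (w₀ : ℂ) (r : ℝ) :
    ∫ θ in Set.Ioo (-Real.pi) Real.pi,
      1 / (((r * Real.cos θ : ℝ) : ℂ) + I * ((r * Real.sin θ : ℝ) : ℂ) + w₀)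
      = (2 * Real.pi) • Real.circleAverage (fun z => 1 / (z + w₀)) 0 r := by
  rw [Real.circleAverage_eq_integral_add (-Real.pi), smul_smul,
    mul_inv_cancel₀ (by positivity), one_smul,
    intervalIntegral.integral_comp_add_right (fun θ => 1 / (circleMap 0 r θ + w₀)),
    ← integral_Ioc_eq_integral_Ioo, ← intervalIntegral.integral_of_le (by linarith [Real.pi_pos])]
  rw [show 0 + -Real.pi = -Real.pi by ring, show 2 * Real.pi + -Real.pi = Real.pi by ring]
  refine intervalIntegral.integral_congr fun θ _ => ?_
  simp only [circleMap, zero_add, Complex.exp_mul_I]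
  push_cast
  congr 2
  ring

lemma aux_radial (σ : ℝ) (hσ : 0 < σ) (R : ℝ) (hR : 0 ≤ R) :
    ∫ r in Set.Ioo 0 R, r * Real.exp (-r ^ 2 / σ ^ 2)
      = σ ^ 2 / 2 * (1 - Real.exp (-R ^ 2 / σ ^ 2)) := by
  rw [← integral_Ioc_eq_integral_Ioo, ← intervalIntegral.integral_of_le hR]
  rw [intervalIntegral.integral_eq_sub_of_hasDerivAt
    (f := fun r => -(σ ^ 2 / 2) * Real.exp (-r ^ 2 / σ ^ 2))]
  · simp
    ring
  · intro x _
    have h := ((((hasDerivAt_pow 2 x).fun_neg).div_const (σ ^ 2)).exp).const_mul (-(σ ^ 2 / 2))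
    refine h.congr_deriv ?_
    push_cast
    field_simp
  · apply Continuous.intervalIntegrable
    fun_prop

lemma aux_integral (σ : ℝ) (hσ : 0 < σ) (w₀ : ℂ) (hw₀ : w₀ ≠ 0) :
    ∫ p : ℝ × ℝ, Real.exp (-(p.1 ^ 2 + p.2 ^ 2) / σ ^ 2) •
      (1 / ((p.1 : ℂ) + I * (p.2 : ℂ) + w₀))
      = (Real.pi * σ ^ 2 * (1 - Real.exp (-‖w₀‖ ^ 2 / σ ^ 2))) • (1 / w₀) := by
  have hint := aux_integrable σ hσ w₀
  set f : ℝ × ℝ → ℂ := fun p => Real.exp (-(p.1 ^ 2 + p.2 ^ 2) / σ ^ 2) •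
      (1 / ((p.1 : ℂ) + I * (p.2 : ℂ) + w₀)) with hf
  have hI : IntegrableOn (fun p : ℝ × ℝ => p.1 • f (polarCoord.symm p))
      (Set.Ioi (0 : ℝ) ×ˢ Set.Ioo (-Real.pi) Real.pi) := by
    have hm : MeasurableSet (Set.Ioi (0 : ℝ) ×ˢ Set.Ioo (-Real.pi) Real.pi) :=
      measurableSet_Ioi.prod measurableSet_Ioo
    have h := (integrableOn_image_iff_integrableOn_abs_det_fderiv_smul volume hm
      (fun p _ => (hasFDerivAt_polarCoord_symm p).hasFDerivWithinAt)
      polarCoord.symm.injOn f).1 hint.integrableOn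
    refine h.congr_fun (fun p hp => ?_) hm
    simp only [det_fderivPolarCoordSymm]
    rw [abs_of_pos hp.1]
  rw [← integral_comp_polarCoord_symm]
  change ∫ p in Set.Ioi (0 : ℝ) ×ˢ Set.Ioo (-Real.pi) Real.pi, _ = _
  rw [Measure.volume_eq_prod] at hI ⊢
  rw [setIntegral_prod _ hI]
  have key : ∀ r ∈ Set.Ioi (0 : ℝ), r ≠ ‖w₀‖ →
      ∫ θ in Set.Ioo (-Real.pi) Real.pi, (r, θ).1 • f (polarCoord.symm (r, θ))
      = (Set.Ioo 0 ‖w₀‖).indicator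
        (fun r => (r * Real.exp (-r ^ 2 / σ ^ 2)) • ((2 * Real.pi) • (1 / w₀))) r := by
    intro r hr hne
    have hr : 0 < r := hr
    have h1 : ∀ θ : ℝ, (r, θ).1 • f (polarCoord.symm (r, θ)) =
        (r * Real.exp (-r ^ 2 / σ ^ 2)) •
          (1 / (((r * Real.cos θ : ℝ) : ℂ) + I * ((r * Real.sin θ : ℝ) : ℂ) + w₀)) := by
      intro θ
      simp only [hf, polarCoord_symm_apply, smul_smul]
      congr 4
      have := Real.cos_sq_add_sin_sq θ
      linear_combination (-r ^ 2) * this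
    simp_rw [h1]
    rw [integral_smul, aux_angle]
    rcases lt_or_gt_of_ne hne with h | h
    · rw [Set.indicator_of_mem (show r ∈ Set.Ioo 0 ‖w₀‖ from ⟨hr, h⟩), aux_avg_lt w₀ r hr h]
    · rw [Set.indicator_of_notMem (fun hh => absurd hh.2 (not_lt.2 h.le)), aux_avg_gt w₀ hw₀ r hr h]
      simp
  have hae : ∀ᵐ r : ℝ ∂volume, r ≠ ‖w₀‖ := by
    simp [ae_iff]
  have h2 : ∫ r in Set.Ioi (0 : ℝ), ∫ θ in Set.Ioo (-Real.pi) Real.pi,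
        (r, θ).1 • f (polarCoord.symm (r, θ))
      = ∫ r in Set.Ioi (0 : ℝ), (Set.Ioo 0 ‖w₀‖).indicator
        (fun r => (r * Real.exp (-r ^ 2 / σ ^ 2)) • ((2 * Real.pi) • (1 / w₀))) r := by
    refine setIntegral_congr_ae measurableSet_Ioi ?_
    filter_upwards [hae] with r hne hr using key r hr hne
  rw [h2, setIntegral_indicator measurableSet_Ioo,
    Set.inter_eq_self_of_subset_right (fun x hx => hx.1), integral_smul_const,
    aux_radial σ hσ _ (norm_nonneg _), smul_smul]
  congr 1
  ring

/-- For a circularly symmetric complex Gaussian `w = a + i b` with mean `0` and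
`E[|w|²] = σ²`, and any `w₀ ≠ 0`, `E[1/(w+w₀)]` exists and
`|E[1/(w+w₀)]|² = (1/σ²)·((1-e^{-ω²})/ω)²` with `ω = |w₀|/σ`. -/
theorem mean_of_inverse_gaussian
    {Ω : Type*} [MeasureSpace Ω] [IsProbabilityMeasure (volume : Measure Ω)]
    (a b : Ω → ℝ) (σ : ℝ) (hσ : 0 < σ)
    (ha : Measurable a) (hb : Measurable b)
    (hlawa : Measure.map a (volume : Measure Ω)
      = ProbabilityTheory.gaussianReal 0 (Real.toNNReal (σ^2/2)))
    (hlawb : Measure.map b (volume : Measure Ω)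
      = ProbabilityTheory.gaussianReal 0 (Real.toNNReal (σ^2/2)))
    (hindep : ProbabilityTheory.IndepFun a b)
    (w₀ : ℂ) (hw₀ : w₀ ≠ 0) :
    Integrable (fun x => 1 / ((a x : ℂ) + Complex.I * (b x : ℂ) + w₀)) ∧
    ‖∫ x, 1 / ((a x : ℂ) + Complex.I * (b x : ℂ) + w₀)‖^2
      = (1/σ^2) * ((1 - Real.exp (-(‖w₀‖/σ)^2)) / (‖w₀‖/σ))^2 := by
  have hs : σ ^ 2 / 2 ≠ 0 := by positivity
  have hv : Real.toNNReal (σ ^ 2 / 2) ≠ 0 := by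
    rw [Ne, Real.toNNReal_eq_zero]
    have : 0 < σ ^ 2 / 2 := by positivity
    linarith
  have hvc : ((Real.toNNReal (σ ^ 2 / 2) : NNReal) : ℝ) = σ ^ 2 / 2 :=
    Real.coe_toNNReal _ (by positivity)
  have hmap : Measure.map (fun x => (a x, b x)) (volume : Measure Ω)
      = (volume : Measure (ℝ × ℝ)).withDensity
        (fun p => ENNReal.ofReal (1 / (Real.pi * σ ^ 2) *
          Real.exp (-(p.1 ^ 2 + p.2 ^ 2) / σ ^ 2))) := by
    rw [(indepFun_iff_map_prod_eq_prod_map_map ha.aemeasurable hb.aemeasurable).1 hindep,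
      hlawa, hlawb, gaussianReal_of_var_ne_zero _ hv,
      prod_withDensity (measurable_gaussianPDF _ _) (measurable_gaussianPDF _ _),
      ← Measure.volume_eq_prod]
    congr 1
    funext p
    rw [gaussianPDF, gaussianPDF, ← ENNReal.ofReal_mul (gaussianPDFReal_nonneg _ _ _)]
    congr 1
    rw [gaussianPDFReal, gaussianPDFReal, hvc]
    have e : 2 * Real.pi * (σ ^ 2 / 2) = Real.pi * σ ^ 2 := by ring
    have e2 : (√(Real.pi * σ ^ 2))⁻¹ * (√(Real.pi * σ ^ 2))⁻¹ = 1 / (Real.pi * σ ^ 2) := by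
      rw [← mul_inv, Real.mul_self_sqrt (by positivity), one_div]
    rw [e, mul_mul_mul_comm, e2, ← Real.exp_add]
    congr 2
    field_simp
    ring
  have hmeas : Measurable (fun p : ℝ × ℝ => 1 / ((p.1 : ℂ) + Complex.I * (p.2 : ℂ) + w₀)) := by
    fun_prop
  have hdm : Measurable (fun p : ℝ × ℝ => ENNReal.ofReal (1 / (Real.pi * σ ^ 2) *
          Real.exp (-(p.1 ^ 2 + p.2 ^ 2) / σ ^ 2))) := by fun_prop
  have hab : AEMeasurable (fun x => (a x, b x)) (volume : Measure Ω) :=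
    (ha.prodMk hb).aemeasurable
  have hlt : ∀ᵐ p : ℝ × ℝ, ENNReal.ofReal (1 / (Real.pi * σ ^ 2) *
          Real.exp (-(p.1 ^ 2 + p.2 ^ 2) / σ ^ 2)) < ⊤ :=
    Filter.Eventually.of_forall fun p => ENNReal.ofReal_lt_top
  have htr : ∀ p : ℝ × ℝ, (ENNReal.ofReal (1 / (Real.pi * σ ^ 2) *
          Real.exp (-(p.1 ^ 2 + p.2 ^ 2) / σ ^ 2))).toReal •
            (1 / ((p.1 : ℂ) + Complex.I * (p.2 : ℂ) + w₀))
      = (1 / (Real.pi * σ ^ 2)) • (Real.exp (-(p.1 ^ 2 + p.2 ^ 2) / σ ^ 2) •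
        (1 / ((p.1 : ℂ) + Complex.I * (p.2 : ℂ) + w₀))) := by
    intro p
    rw [ENNReal.toReal_ofReal (by positivity), smul_smul]
  constructor
  · have h1 : Integrable (fun p : ℝ × ℝ => 1 / ((p.1 : ℂ) + Complex.I * (p.2 : ℂ) + w₀))
        (Measure.map (fun x => (a x, b x)) (volume : Measure Ω)) := by
      rw [hmap, integrable_withDensity_iff_integrable_smul' hdm hlt]
      simp_rw [htr]
      exact (aux_integrable σ hσ w₀).smul (1 / (Real.pi * σ ^ 2))
    exact h1.comp_aemeasurable hab
  · have h2 := integral_map hab (hmeas.aestronglyMeasurable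
      (μ := Measure.map (fun x => (a x, b x)) (volume : Measure Ω)))
    simp only at h2
    rw [← h2, hmap, integral_withDensity_eq_integral_toReal_smul hdm hlt]
    simp_rw [htr]
    rw [integral_smul, aux_integral σ hσ w₀ hw₀, smul_smul, norm_smul, mul_pow,
      Real.norm_eq_abs, sq_abs, norm_div, norm_one]
    have hn : ‖w₀‖ ≠ 0 := norm_ne_zero_iff.2 hw₀
    have e : -(‖w₀‖ / σ) ^ 2 = -‖w₀‖ ^ 2 / σ ^ 2 := by ring
    rw [e]
    field_simp
end
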